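/- Let G be a connected graph in which no three distinct vertices are pairwise true twins, X a cluster modulator of G, and 𝒞 an equivalence class of identical cliques of G − X with |𝒞| ≥ 2^{|X|+2} + |X| + 2. Then for every clique C1 ∈ 𝒞, there exists a minimum resolving set S of G with |S ∩ V(C1)| = max(1, t(𝒞)). -/

import Mathlib

open SimpleGraph

variable {V : Type*}

/-- Two distinct vertices are true twins if they have equal closed neighborhoods. -/
def TrueTwins (G : SimpleGraph V) (u v : V) : Prop :=
  u ≠ v ∧ insert u (G.neighborSet u) = insert v (G.neighborSet v)

/-- Two distinct vertices are false twins if they have equal open neighborhoods. -/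
def FalseTwins (G : SimpleGraph V) (u v : V) : Prop :=
  u ≠ v ∧ G.neighborSet u = G.neighborSet v

/-- A set `S` is a resolving set of `G`. -/
def IsResolving {W : Type*} (G : SimpleGraph W) (S : Set W) : Prop :=
  ∀ u v : W, u ≠ v → ∃ w ∈ S, G.dist w u ≠ G.dist w v

/-- A graph is a cluster graph: every connected component is a clique. -/
def IsClusterGraph {W : Type*} (H : SimpleGraph W) : Prop :=
  ∀ a b : W, H.Reachable a b → a = b ∨ H.Adj a b

/-- `X` is a cluster modulator of `G`: `G - X` is a cluster graph. -/
def IsClusterModulator (G : SimpleGraph V) (X : Set V) : Prop :=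
  IsClusterGraph (G.induce Xᶜ)

/-- `C` is a clique of `G - X`, i.e. a connected component of `G - X`
(which is a clique when `X` is a cluster modulator). -/
def IsCliqueComponent (G : SimpleGraph V) (X C : Set V) : Prop :=
  C.Nonempty ∧ C ⊆ Xᶜ ∧ (∀ a ∈ C, ∀ b ∈ C, a ≠ b → G.Adj a b) ∧
    (∀ a ∈ C, ∀ b : V, b ∉ X → G.Adj a b → b ∈ C)

/-- Two vertices are clones (w.r.t. the modulator `X`) if they have the same
neighborhood in `X`. -/
def Clones (G : SimpleGraph V) (X : Set V) (u v : V) : Prop :=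
  G.neighborSet u ∩ X = G.neighborSet v ∩ X

/-- Two cliques of `G - X` are identical if their signatures (multisets of
neighborhoods in `X`) coincide, i.e. there is a bijection matching vertices
with equal neighborhoods in `X`. -/
def Identical (G : SimpleGraph V) (X C1 C2 : Set V) : Prop :=
  ∃ f : ↥C1 ≃ ↥C2, ∀ u : ↥C1, G.neighborSet (↑(f u)) ∩ X = G.neighborSet (↑u) ∩ X

/-- `𝒞` is an equivalence class of identical cliques of `G - X`:
a maximal set of pairwise identical cliques of `G - X`. -/
def IsIdenticalClass (G : SimpleGraph V) (X : Set V) (𝒞 : Set (Set V)) : Prop :=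
  (∀ C ∈ 𝒞, IsCliqueComponent G X C) ∧
  (∀ C1 ∈ 𝒞, ∀ C2 ∈ 𝒞, Identical G X C1 C2) ∧
  (∀ C, IsCliqueComponent G X C → (∃ C' ∈ 𝒞, Identical G X C C') → C ∈ 𝒞)

/-- The number of unordered pairs of true twins of `G` contained in `C`. -/
noncomputable def twinPairCount (G : SimpleGraph V) (C : Set V) : ℕ :=
  {p : Set V | ∃ u ∈ C, ∃ v ∈ C, TrueTwins G u v ∧ p = {u, v}}.ncard

/-- No three distinct vertices of `G` are pairwise true twins. -/
def NoThreeTrueTwins (G : SimpleGraph V) : Prop :=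
  ¬ ∃ u v w : V, TrueTwins G u v ∧ TrueTwins G u w ∧ TrueTwins G v w

/-- No three distinct vertices of `G` are pairwise false twins. -/
def NoThreeFalseTwins (G : SimpleGraph V) : Prop :=
  ¬ ∃ u v w : V, FalseTwins G u v ∧ FalseTwins G u w ∧ FalseTwins G v w

/-- `I` is an independent set of `G - X` corresponding to a connected component
of the complement of `G - X`. -/
def IsCoComponent (G : SimpleGraph V) (X I : Set V) : Prop :=
  I.Nonempty ∧ I ⊆ Xᶜ ∧ (∀ a ∈ I, ∀ b ∈ I, a ≠ b → ¬ G.Adj a b) ∧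
    (∀ a ∈ I, ∀ b : V, b ∉ X → a ≠ b → ¬ G.Adj a b → b ∈ I)

/-- Graph automorphisms preserve distances. -/
theorem dist_iso (G : SimpleGraph V) (hG : G.Connected) (φ : G ≃g G) (u v : V) :
    G.dist (φ u) (φ v) = G.dist u v := by
  have key : ∀ (ψ : G ≃g G) (a b : V), G.dist (ψ a) (ψ b) ≤ G.dist a b := by
    intro ψ a b
    obtain ⟨p, hp⟩ := hG.exists_walk_length_eq_dist a b
    rw [← hp, ← Walk.length_map ψ.toHom p]
    exact dist_le _
  refine le_antisymm (key φ u v) ?_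
  simpa using key φ.symm (φ u) (φ v)

theorem TrueTwins.adj_iff {G : SimpleGraph V} {u v : V} (h : TrueTwins G u v) {y : V}
    (hu : y ≠ u) (hv : y ≠ v) : G.Adj u y ↔ G.Adj v y := by
  have := Set.ext_iff.mp h.2 y
  simpa [hu, hv] using this

theorem TrueTwins.symm {G : SimpleGraph V} {u v : V} (h : TrueTwins G u v) : TrueTwins G v u :=
  ⟨h.1.symm, h.2.symm⟩

/-- Interchanging two true twins is a graph automorphism. -/
noncomputable def TrueTwins.swapIso {G : SimpleGraph V} {u v : V} (h : TrueTwins G u v) :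
    G ≃g G :=
  open Classical in
  { toEquiv := Equiv.swap u v
    map_rel_iff' := by
      intro a b
      have key := fun {y : V} => h.adj_iff (y := y)
      have key' : ∀ {y : V}, y ≠ u → y ≠ v → (G.Adj y u ↔ G.Adj y v) := fun h1 h2 => by
        rw [G.adj_comm, key h1 h2, G.adj_comm]
      have hne := h.1
      have hc := G.adj_comm u v
      by_cases ha : a = u <;> by_cases ha' : a = v <;> by_cases hb : b = u <;>
        by_cases hb' : b = v <;>
        simp_all [Equiv.swap_apply_of_ne_of_ne] }

/-- A resolving set contains a member of each pair of true twins. -/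
theorem IsResolving.mem_or_mem_of_trueTwins {G : SimpleGraph V} (hG : G.Connected) {S : Set V}
    (hS : IsResolving G S) {u v : V} (h : TrueTwins G u v) : u ∈ S ∨ v ∈ S := by
  classical
  obtain ⟨w, hw, hne⟩ := hS u v h.1
  by_contra! hcon
  apply hne
  have hwu : w ≠ u := fun e => hcon.1 (e ▸ hw)
  have hwv : w ≠ v := fun e => hcon.2 (e ▸ hw)
  have e1 : h.swapIso w = w := Equiv.swap_apply_of_ne_of_ne hwu hwv
  have e2 : h.swapIso u = v := Equiv.swap_apply_left u v
  rw [← dist_iso G hG h.swapIso w u, e1, e2]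

/-- The set of unordered pairs of true twins contained in `C`. -/
def twinPairs (G : SimpleGraph V) (C : Set V) : Set (Set V) :=
  {p : Set V | ∃ u ∈ C, ∃ v ∈ C, TrueTwins G u v ∧ p = {u, v}}

theorem eq_of_mem_twinPairs {G : SimpleGraph V} (hT : NoThreeTrueTwins G) {C p q : Set V}
    (hp : p ∈ twinPairs G C) (hq : q ∈ twinPairs G C) {w : V} (hwp : w ∈ p) (hwq : w ∈ q) :
    p = q := by
  have key : ∀ {r : Set V}, r ∈ twinPairs G C → w ∈ r → ∃ z, TrueTwins G w z ∧ r = {w, z} := by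
    rintro r ⟨u, _, v, _, huv, rfl⟩ (rfl | rfl)
    · exact ⟨v, huv, rfl⟩
    · exact ⟨u, huv.symm, Set.pair_comm _ _⟩
  obtain ⟨a, ha, rfl⟩ := key hp hwp
  obtain ⟨b, hb, rfl⟩ := key hq hwq
  by_cases hab : a = b
  · rw [hab]
  · exact (hT ⟨w, a, b, ha, hb, hab, ha.2.symm.trans hb.2⟩).elim

theorem IsResolving.twinPairCount_le [Finite V] {G : SimpleGraph V} (hG : G.Connected)
    (hT : NoThreeTrueTwins G) {S : Set V} (hS : IsResolving G S) (C : Set V) :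
    twinPairCount G C ≤ (S ∩ C).ncard := by
  have hex : ∀ p ∈ twinPairs G C, ∃ w, w ∈ p ∧ w ∈ S ∩ C := by
    rintro p ⟨u, hu, v, hv, huv, rfl⟩
    rcases hS.mem_or_mem_of_trueTwins hG huv with h | h
    · exact ⟨u, by simp, h, hu⟩
    · exact ⟨v, by simp, h, hv⟩
  have := hG.nonempty
  choose! g hg using hex
  refine Set.ncard_le_ncard_of_injOn g (fun p hp => (hg p hp).2) (fun p hp q hq hpq => ?_)
    (Set.toFinite _)
  exact eq_of_mem_twinPairs hT hp hq (hg p hp).1 (hpq ▸ (hg q hq).1)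

/-- A nonempty set of vertices of `C` meeting every pair of true twins of `C`. -/
theorem exists_twin_transversal [Finite V] (G : SimpleGraph V) {C : Set V} (hC : C.Nonempty) :
    ∃ T ⊆ C, T.Nonempty ∧ (∀ u ∈ C, ∀ v ∈ C, TrueTwins G u v → u ∈ T ∨ v ∈ T) ∧
      T.ncard ≤ max 1 (twinPairCount G C) := by
  have hex : ∀ p ∈ twinPairs G C, ∃ w, w ∈ p ∧ w ∈ C := by
    rintro p ⟨u, hu, v, hv, huv, rfl⟩
    exact ⟨u, by simp, hu⟩
  have : Nonempty V := hC.to_type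
  choose! g hg using hex
  rcases (twinPairs G C).eq_empty_or_nonempty with h0 | h0
  · obtain ⟨c, hc⟩ := hC
    refine ⟨{c}, by simpa using hc, by simp, fun u hu v hv huv => ?_, by simp⟩
    have : ({u, v} : Set V) ∈ twinPairs G C := ⟨u, hu, v, hv, huv, rfl⟩
    simp [h0] at this
  · refine ⟨g '' twinPairs G C, ?_, h0.image g, fun u hu v hv huv => ?_,
      (Set.ncard_image_le (Set.toFinite _)).trans (le_max_right _ _)⟩
    · rintro _ ⟨p, hp, rfl⟩
      exact (hg p hp).2
    · have hm : ({u, v} : Set V) ∈ twinPairs G C := ⟨u, hu, v, hv, huv, rfl⟩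
      rcases (hg _ hm).1 with h | h
      · exact Or.inl ⟨_, hm, h⟩
      · exact Or.inr ⟨_, hm, h⟩

theorem IsCliqueComponent.subset_of_mem {G : SimpleGraph V} {X C D : Set V}
    (hC : IsCliqueComponent G X C) (hD : IsCliqueComponent G X D) {a : V} (haC : a ∈ C)
    (haD : a ∈ D) : C ⊆ D := by
  intro b hb
  by_cases hab : a = b
  · exact hab ▸ haD
  · exact hD.2.2.2 a haD b (hC.2.1 hb) (hC.2.2.1 a haC b hb hab)

theorem IsCliqueComponent.disjoint {G : SimpleGraph V} {X C D : Set V}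
    (hC : IsCliqueComponent G X C) (hD : IsCliqueComponent G X D) (hne : C ≠ D) :
    Disjoint C D :=
  Set.disjoint_left.mpr fun _ h1 h2 =>
    hne ((hC.subset_of_mem hD h1 h2).antisymm (hD.subset_of_mem hC h2 h1))

/-- Every walk leaving a clique of `G - X` passes through `X`. -/
theorem IsCliqueComponent.exists_dist_add_dist_le {G : SimpleGraph V} (hG : G.Connected)
    {X C : Set V} (hC : IsCliqueComponent G X C) {w u : V} (p : G.Walk w u) (hw : w ∈ C)
    (hu : u ∉ C) : ∃ x ∈ X, G.dist w x + G.dist x u ≤ p.length := by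
  induction p with
  | nil => exact (hu hw).elim
  | @cons a b c h q ih =>
    have hab : G.dist a b ≤ 1 := (dist_eq_one_iff_adj.mpr h).le
    by_cases hb : b ∈ C
    · obtain ⟨x, hx, hle⟩ := ih hb hu
      have := hG.dist_triangle (u := a) (v := b) (w := x)
      exact ⟨x, hx, by rw [Walk.length_cons]; omega⟩
    · refine ⟨b, by_contra fun hbX => hb (hC.2.2.2 a hw b hbX h), ?_⟩
      have := dist_le q
      rw [Walk.length_cons]
      omega

/-- Vertices of a clique of `G - X` do not resolve more pairs outside the clique
than `X` does. -/
theorem IsCliqueComponent.dist_eq_dist {G : SimpleGraph V} (hG : G.Connected) {X C : Set V}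
    (hC : IsCliqueComponent G X C) {w u v : V} (hw : w ∈ C) (hu : u ∉ C) (hv : v ∉ C)
    (h : ∀ x ∈ X, G.dist x u = G.dist x v) : G.dist w u = G.dist w v := by
  have key : ∀ {a b : V}, a ∉ C → (∀ x ∈ X, G.dist x a = G.dist x b) →
      G.dist w b ≤ G.dist w a := by
    intro a b ha hab
    obtain ⟨p, hp⟩ := hG.exists_walk_length_eq_dist w a
    obtain ⟨x, hx, hle⟩ := hC.exists_dist_add_dist_le hG p hw ha
    rw [hab x hx, hp] at hle
    exact hG.dist_triangle.trans hle
  exact le_antisymm (key hv fun x hx => (h x hx).symm) (key hu h)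

/-- Clones in the same clique of `G - X` are true twins. -/
theorem IsCliqueComponent.trueTwins {G : SimpleGraph V} {X C : Set V}
    (hC : IsCliqueComponent G X C) {u v : V} (hu : u ∈ C) (hv : v ∈ C) (hne : u ≠ v)
    (h : ∀ x ∈ X, (G.Adj u x ↔ G.Adj v x)) : TrueTwins G u v := by
  refine ⟨hne, Set.ext fun y => ?_⟩
  simp only [Set.mem_insert_iff, mem_neighborSet]
  by_cases hy : y ∈ X
  · have h1 : y ≠ u := fun e => hC.2.1 hu (e ▸ hy)
    have h2 : y ≠ v := fun e => hC.2.1 hv (e ▸ hy)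
    simp [h1, h2, h y hy]
  · have key : ∀ a ∈ C, (y = a ∨ G.Adj a y ↔ y ∈ C) := by
      intro a ha
      refine ⟨?_, fun hyC => ?_⟩
      · rintro (rfl | hadj)
        · exact ha
        · exact hC.2.2.2 a ha y hy hadj
      · by_cases e : y = a
        · exact Or.inl e
        · exact Or.inr (hC.2.2.1 a ha y hyC (Ne.symm e))
    rw [key u hu, key v hv]

/-- Two distinct identical cliques of `G - X` are interchanged by an automorphism fixing all
other vertices. -/
theorem Identical.exists_iso {G : SimpleGraph V} {X C D : Set V}
    (hC : IsCliqueComponent G X C) (hD : IsCliqueComponent G X D) (hne : C ≠ D)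
    (hid : Identical G X C D) :
    ∃ φ : G ≃g G, (∀ v, φ (φ v) = v) ∧ (∀ v ∈ C, φ v ∈ D) ∧ (∀ v ∈ D, φ v ∈ C) ∧
      ∀ v, v ∉ C → v ∉ D → φ v = v := by
  classical
  obtain ⟨f, hf⟩ := hid
  have hdis := hC.disjoint hD hne
  let σ : V → V := fun v =>
    if h : v ∈ C then f ⟨v, h⟩ else if h : v ∈ D then f.symm ⟨v, h⟩ else v
  have σC : ∀ v (h : v ∈ C), σ v = f ⟨v, h⟩ := fun v h => by simp [σ, h]
  have σD : ∀ v (h : v ∈ D), σ v = f.symm ⟨v, h⟩ := fun v h => by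
    simp [σ, h, Set.disjoint_right.mp hdis h]
  have σ0 : ∀ v, v ∉ C → v ∉ D → σ v = v := fun v h h' => by simp [σ, h, h']
  have memD : ∀ v ∈ C, σ v ∈ D := fun v h => by rw [σC v h]; exact (f ⟨v, h⟩).2
  have memC : ∀ v ∈ D, σ v ∈ C := fun v h => by rw [σD v h]; exact (f.symm ⟨v, h⟩).2
  have hinv : Function.Involutive σ := by
    intro v
    by_cases h : v ∈ C
    · rw [σD _ (memD v h)]
      simp [σC v h]
    · by_cases h' : v ∈ D
      · rw [σC _ (memC v h')]
        simp [σD v h']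
      · rw [σ0 v h h', σ0 v h h']
  have σX : ∀ x ∈ X, σ x = x := fun x hx => σ0 x (fun h => hC.2.1 h hx) fun h => hD.2.1 h hx
  have adjX : ∀ v x, x ∈ X → (G.Adj (σ v) x ↔ G.Adj v x) := by
    intro v x hx
    by_cases h : v ∈ C
    · have := Set.ext_iff.mp (hf ⟨v, h⟩) x
      simpa [hx, σC v h] using this
    · by_cases h' : v ∈ D
      · have := Set.ext_iff.mp (hf (f.symm ⟨v, h'⟩)) x
        simpa [hx, σD v h', iff_comm] using this
      · rw [σ0 v h h']
  have adjσ : ∀ a b, G.Adj a b → G.Adj (σ a) (σ b) := by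
    intro a b hab
    by_cases hb : b ∈ X
    · rw [σX b hb, adjX a b hb]
      exact hab
    by_cases ha : a ∈ X
    · rw [σX a ha, G.adj_comm, adjX b a ha]
      exact hab.symm
    have hσne : σ a ≠ σ b := fun e => hab.ne (hinv.injective e)
    by_cases haC : a ∈ C
    · exact hD.2.2.1 _ (memD a haC) _ (memD b (hC.2.2.2 a haC b hb hab)) hσne
    by_cases haD : a ∈ D
    · exact hC.2.2.1 _ (memC a haD) _ (memC b (hD.2.2.2 a haD b hb hab)) hσne
    rw [σ0 a haC haD, σ0 b (fun h => haC (hC.2.2.2 b h a ha hab.symm))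
      fun h => haD (hD.2.2.2 b h a ha hab.symm)]
    exact hab
  refine ⟨⟨hinv.toPerm, ⟨fun h => ?_, fun h => adjσ _ _ h⟩⟩, hinv, memD, memC, σ0⟩
  simpa [hinv _] using adjσ _ _ h

/-- A resolving set misses at most one clique of a class of identical cliques. -/
theorem IsResolving.eq_of_inter_eq_empty {G : SimpleGraph V} (hG : G.Connected) {X S C D : Set V}
    (hS : IsResolving G S) (hC : IsCliqueComponent G X C) (hD : IsCliqueComponent G X D)
    (hid : Identical G X C D) (hSC : S ∩ C = ∅) (hSD : S ∩ D = ∅) : C = D := by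
  by_contra hne
  obtain ⟨φ, -, hCD, -, hfix⟩ := hid.exists_iso hC hD hne
  obtain ⟨u, hu⟩ := hC.1
  have hune : u ≠ φ u := fun e =>
    Set.disjoint_left.mp (hC.disjoint hD hne) hu (e ▸ hCD u hu)
  obtain ⟨w, hw, hdist⟩ := hS u (φ u) hune
  have hwφ : φ w = w := hfix w (fun h => (hSC ▸ (⟨hw, h⟩ : w ∈ S ∩ C) : w ∈ (∅ : Set V)))
    fun h => (hSD ▸ (⟨hw, h⟩ : w ∈ S ∩ D) : w ∈ (∅ : Set V))
  apply hdist
  rw [← dist_iso G hG φ w u, hwφ]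

theorem IsResolving.image {G : SimpleGraph V} (hG : G.Connected) {S : Set V}
    (hS : IsResolving G S) (φ : G ≃g G) : IsResolving G (φ '' S) := by
  intro u v huv
  obtain ⟨w, hw, hne⟩ := hS (φ.symm u) (φ.symm v) fun e => huv (φ.symm.injective e)
  refine ⟨φ w, ⟨w, hw, rfl⟩, ?_⟩
  rw [← dist_iso G hG φ, ← dist_iso G hG φ w] at hne
  simpa using hne

/-- On a family of cliques of `G - X`, a resolving set may be replaced by `X` together with
a transversal of the true twin pairs of each clique. -/
theorem IsResolving.replace {G : SimpleGraph V} (hG : G.Connected) {X S : Set V}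
    (hS : IsResolving G S) {𝒞 : Set (Set V)} (h𝒞 : ∀ C ∈ 𝒞, IsCliqueComponent G X C)
    {T : Set V → Set V} (hsub : ∀ C ∈ 𝒞, T C ⊆ C) (hne : ∀ C ∈ 𝒞, (T C).Nonempty)
    (htw : ∀ C ∈ 𝒞, ∀ u ∈ C, ∀ v ∈ C, TrueTwins G u v → u ∈ T C ∨ v ∈ T C) :
    IsResolving G ((S \ ⋃ C ∈ 𝒞, C) ∪ X ∪ ⋃ C ∈ 𝒞, T C) := by
  intro u v huv
  by_contra! hcon
  have hX : ∀ x ∈ X, G.dist x u = G.dist x v := fun x hx => hcon x (Or.inl (Or.inr hx))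
  have hTd : ∀ C ∈ 𝒞, ∀ z ∈ T C, G.dist z u = G.dist z v := fun C hC z hz =>
    hcon z (Or.inr (Set.mem_biUnion hC hz))
  have hself : ∀ {z : V}, (z = u ∨ z = v) → G.dist z u ≠ G.dist z v := by
    rintro z (rfl | rfl) h
    · rw [dist_self] at h
      exact huv (hG.dist_eq_zero_iff.mp h.symm)
    · rw [dist_self] at h
      exact huv (hG.dist_eq_zero_iff.mp h).symm
  have huX : u ∉ X := fun h => hself (Or.inl rfl) (hX u h)
  have hvX : v ∉ X := fun h => hself (Or.inr rfl) (hX v h)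
  obtain ⟨w, hw, hwd⟩ := hS u v huv
  have hwU : w ∈ ⋃ C ∈ 𝒞, C := by
    by_contra h
    exact hwd (hcon w (Or.inl (Or.inl ⟨hw, h⟩)))
  obtain ⟨E, hE, hwE⟩ := Set.mem_iUnion₂.mp hwU
  have hcomp := h𝒞 E hE
  obtain ⟨z, hz⟩ := hne E hE
  have hzE := hsub E hE hz
  have hzd := hTd E hE z hz
  have cross : ∀ {a b : V}, a ∈ E → b ∉ E → b ∉ X → G.dist z a ≠ G.dist z b := by
    intro a b ha hb hbX hab
    by_cases hza : z = a
    · rw [hza, dist_self] at hab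
      exact hb (hG.dist_eq_zero_iff.mp hab.symm ▸ ha)
    · rw [dist_eq_one_iff_adj.mpr (hcomp.2.2.1 z hzE a ha hza)] at hab
      exact hb (hcomp.2.2.2 z hzE b hbX (dist_eq_one_iff_adj.mp hab.symm))
  by_cases hu : u ∈ E <;> by_cases hv : v ∈ E
  · have htwins : TrueTwins G u v := hcomp.trueTwins hu hv huv fun x hx => by
      rw [G.adj_comm, ← dist_eq_one_iff_adj, hX x hx, dist_eq_one_iff_adj, G.adj_comm]
    rcases htw E hE u hu v hv htwins with h | h
    · exact hself (Or.inl rfl) (hTd E hE u h)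
    · exact hself (Or.inr rfl) (hTd E hE v h)
  · exact cross hu hv hvX hzd
  · exact cross hv hu huX hzd.symm
  · exact hwd (hcomp.dist_eq_dist hG hwE hu hv hX)

/-- Some clique of a large class contains exactly `max 1 t` vertices of a minimum
resolving set. -/
theorem exists_ncard_inter_eq [Finite V] {G : SimpleGraph V} (hG : G.Connected)
    (hT : NoThreeTrueTwins G) {X : Set V} {𝒞 : Set (Set V)} (h𝒞 : IsIdenticalClass G X 𝒞)
    {t : ℕ} (ht : ∀ C ∈ 𝒞, twinPairCount G C = t) (hcard : X.ncard + 2 < 𝒞.ncard)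
    {S : Set V} (hS : IsResolving G S) (hmin : ∀ T : Set V, IsResolving G T → S.ncard ≤ T.ncard) :
    ∃ C ∈ 𝒞, (S ∩ C).ncard = max 1 t := by
  classical
  by_contra! hcon
  obtain ⟨hcomp, hid, -⟩ := h𝒞
  have hex : ∀ C ∈ 𝒞, ∃ T ⊆ C, T.Nonempty ∧
      (∀ u ∈ C, ∀ v ∈ C, TrueTwins G u v → u ∈ T ∨ v ∈ T) ∧ T.ncard ≤ max 1 t := by
    intro C hC
    rw [← ht C hC]
    exact exists_twin_transversal G (hcomp C hC).1
  choose! T hsub hne htw hTcard using hex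
  have hle := hmin _ (hS.replace hG hcomp hsub hne htw)
  obtain ⟨F, rfl⟩ : ∃ F : Finset (Set V), 𝒞 = F := ⟨(Set.toFinite 𝒞).toFinset, by simp⟩
  simp only [Finset.mem_coe] at *
  rw [Set.ncard_coe_finset] at hcard
  have hunion : (⋃ C ∈ F, T C).ncard ≤ F.card * max 1 t := by
    refine (Finset.set_ncard_biUnion_le F T).trans ?_
    simpa using Finset.sum_le_card_nsmul F _ _ hTcard
  have hsplit : (S ∩ ⋃ C ∈ F, C).ncard = ∑ C ∈ F, (S ∩ C).ncard := by
    rw [Set.inter_iUnion₂, ← finsum_mem_coe_finset]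
    exact F.finite_toSet.ncard_biUnion (fun _ _ => Set.toFinite _) fun C hC D hD hCD =>
      ((hcomp C hC).disjoint (hcomp D hD) hCD).mono Set.inter_subset_right Set.inter_subset_right
  have hempty : ∑ C ∈ F, (if S ∩ C = ∅ then 2 else 0) ≤ 2 := by
    rw [← Finset.sum_filter, Finset.sum_const, smul_eq_mul]
    have : (F.filter fun C => S ∩ C = ∅).card ≤ 1 := by
      refine Finset.card_le_one.mpr fun C hC D hD => ?_
      rw [Finset.mem_filter] at hC hD
      exact hS.eq_of_inter_eq_empty hG (hcomp C hC.1) (hcomp D hD.1) (hid C hC.1 D hD.1) hC.2 hD.2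
    omega
  have hlow : F.card * (max 1 t + 1) ≤
      ∑ C ∈ F, ((S ∩ C).ncard + if S ∩ C = ∅ then 2 else 0) := by
    rw [← smul_eq_mul]
    refine Finset.card_nsmul_le_sum F _ _ fun C hC => ?_
    have h1 := hS.twinPairCount_le hG hT C
    rw [ht C hC] at h1
    have h2 := hcon C hC
    split_ifs with h
    · rw [h, Set.ncard_empty] at h1 ⊢
      omega
    · have : (S ∩ C).ncard ≠ 0 := by
        rw [Ne, Set.ncard_eq_zero]
        exact h
      omega
  rw [Finset.sum_add_distrib, mul_add] at hlow
  have h1 := Set.ncard_union_le ((S \ ⋃ C ∈ F, C) ∪ X) (⋃ C ∈ F, T C)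
  have h2 := Set.ncard_union_le (S \ ⋃ C ∈ F, C) X
  have h3 := Set.ncard_inter_add_ncard_sdiff_eq_ncard S (⋃ C ∈ F, C)
  omega

/-- there is a minimum resolving set intersecting `C1` in exactly
`max 1 t(𝒞)` vertices. -/
theorem exists_min_resolving_exact_on_clique [Fintype V] (G : SimpleGraph V) (hG : G.Connected)
    (hT : NoThreeTrueTwins G) (X : Set V) (hX : IsClusterModulator G X)
    (𝒞 : Set (Set V)) (h𝒞 : IsIdenticalClass G X 𝒞)
    (t : ℕ) (ht : ∀ C ∈ 𝒞, twinPairCount G C = t)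
    (hcard : 2 ^ (X.ncard + 2) + X.ncard + 2 ≤ 𝒞.ncard)
    (C1 : Set V) (hC1 : C1 ∈ 𝒞) :
    ∃ S : Set V, IsResolving G S ∧ (∀ T : Set V, IsResolving G T → S.ncard ≤ T.ncard) ∧
      (S ∩ C1).ncard = max 1 t := by
  have huniv : IsResolving G Set.univ := fun u v huv => ⟨u, trivial, by
    rw [dist_self]
    exact (hG.pos_dist_of_ne huv).ne⟩
  obtain ⟨S, hS, hmin⟩ := (Set.toFinite {S : Set V | IsResolving G S}).exists_minimalFor
    Set.ncard _ ⟨_, huniv⟩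
  have hmin' : ∀ T : Set V, IsResolving G T → S.ncard ≤ T.ncard := fun T hT' =>
    (le_total S.ncard T.ncard).elim id fun h => hmin hT' h
  have hlt : X.ncard + 2 < 𝒞.ncard := by
    have := Nat.one_le_two_pow (n := X.ncard + 2)
    omega
  obtain ⟨C, hC, hSC⟩ := exists_ncard_inter_eq hG hT h𝒞 ht hlt hS hmin'
  by_cases hne : C = C1
  · exact ⟨S, hS, hmin', hne ▸ hSC⟩
  obtain ⟨φ, hφ, hCC1, hC1C, -⟩ :=
    (h𝒞.2.1 C hC C1 hC1).exists_iso (h𝒞.1 C hC) (h𝒞.1 C1 hC1) hne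
  refine ⟨φ '' S, hS.image hG φ, ?_, ?_⟩
  · rw [Set.ncard_image_of_injective _ φ.injective]
    exact hmin'
  · have himg : φ '' C = C1 := by
      refine Set.Subset.antisymm ?_ fun v hv => ⟨φ v, hC1C v hv, hφ v⟩
      rintro _ ⟨v, hv, rfl⟩
      exact hCC1 v hv
    rw [← himg, ← Set.image_inter φ.injective, Set.ncard_image_of_injective _ φ.injective, hSC]
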